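/- arXiv:1412.4527 — 2 statements merged into one kernel-verified Lean document; each statement's English description precedes it below -/
import Mathlib

section
/- Let T > 0, k ∈ ℕ, and let 0 < r₁ < r₂ < … < r_k. For j = 1,…,k let g_j : ℝ → ℝ be Lipschitz continuous with g_j(0) = 0 and 0 ≤ g_j'(v) ≤ μ_j for a.e. v ∈ ℝ, where μ_j ≥ 0 are constants. Let b ∈ C[0,T] with 0 ≤ b(t) ≤ b̄ for all t ∈ [0,T]. Let q₁, q₂ : [0,T] → ℝ be absolutely continuous, for i = 1,2 and j = 1,…,k let ξ_{r_j}^i be the solution of the play variational inequality with threshold r_j and input q_i, and suppose that q_i(t) + b(t)·Σ_{j=1}^{k} g_j(ξ_{r_j}^i(t)) = w_i(t) for all t ∈ [0,T], i = 1,2, where w₁, w₂ ∈ C[0,T]. Then max_{t∈[0,T]} |q₁(t) − q₂(t)| ≤ ρ_k · max_{t∈[0,T]} |w₁(t) − w₂(t)|, where ρ_k = Π_{j=1}^{k} (1 + b̄ μ_j). -/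
open MeasureTheory Set

/-- `q` is absolutely continuous on `[0,T]` with a.e. derivative `q'`,
encoded via the fundamental theorem of calculus. -/
def IsACOn (T : ℝ) (q q' : ℝ → ℝ) : Prop :=
  IntegrableOn q' (Icc 0 T) ∧ ∀ t ∈ Icc 0 T, q t = q 0 + ∫ τ in (0:ℝ)..t, q' τ

/-- `ξ` (with a.e. derivative `ξ'`) solves the play variational inequality
with threshold `r` and input `q` on `[0,T]`:
(i) `|q - ξ| ≤ r` on `[0,T]`, (ii) `ξ'(t)(q(t) - ξ(t) - r z) ≥ 0` for a.e. `t`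
and all `z ∈ [-1,1]`, (iii) `ξ(0) = max{q(0) - r, min{0, q(0) + r}}`. -/
def IsPlaySol (T r : ℝ) (q ξ ξ' : ℝ → ℝ) : Prop :=
  IsACOn T ξ ξ' ∧
  (∀ t ∈ Icc 0 T, |q t - ξ t| ≤ r) ∧
  (∀ᵐ t ∂(volume.restrict (Ioo 0 T)),
    ∀ z ∈ Icc (-1:ℝ) 1, ξ' t * (q t - ξ t - r * z) ≥ 0) ∧
  ξ 0 = max (q 0 - r) (min 0 (q 0 + r))

/-- An absolutely continuous function that starts below `c` and does not increase where it
exceeds `c` stays below `c`. -/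
theorem IsACOn.le_of_deriv_nonpos {T c : ℝ} {F F' : ℝ → ℝ} (hF : IsACOn T F F') (h0 : F 0 ≤ c)
    (hd : ∀ᵐ t ∂(volume.restrict (Ioo 0 T)), c < F t → F' t ≤ 0) :
    ∀ t ∈ Icc 0 T, F t ≤ c := by
  intro t ht
  by_contra! hlt
  obtain ⟨hint, hFTC⟩ := hF
  have hII : ∀ x ∈ Icc 0 T, IntervalIntegrable F' volume 0 x := fun x hx =>
    (intervalIntegrable_iff_integrableOn_Icc_of_le hx.1).2
      (hint.mono_set (Icc_subset_Icc_right hx.2))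
  have hcont : ContinuousOn F (Icc 0 T) := by
    have h1 : ContinuousOn (fun x => F 0 + ∫ τ in (0:ℝ)..x, F' τ) (Icc 0 T) :=
      continuousOn_const.add (intervalIntegral.continuousOn_primitive_interval
        (by rwa [uIcc_of_le (ht.1.trans ht.2)]) |>.mono (by rw [uIcc_of_le (ht.1.trans ht.2)]))
    exact h1.congr hFTC
  have hcpt : IsCompact (Icc 0 t ∩ F ⁻¹' Iic c) := by
    refine isCompact_Icc.of_isClosed_subset ?_ inter_subset_left
    exact (hcont.mono (Icc_subset_Icc_right ht.2)).preimage_isClosed_of_isClosed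
      isClosed_Icc isClosed_Iic
  obtain ⟨s, ⟨⟨hs0, hst⟩, hsc⟩, hmax⟩ := hcpt.exists_isGreatest ⟨0, ⟨le_rfl, ht.1⟩, h0⟩
  have hsc : F s ≤ c := hsc
  have hsT : s ∈ Icc 0 T := ⟨hs0, hst.trans ht.2⟩
  have hdiff : F t - F s = ∫ τ in s..t, F' τ := by
    rw [hFTC t ht, hFTC s hsT, ← intervalIntegral.integral_interval_sub_left (hII t ht) (hII s hsT)]
    ring
  have hnonpos : ∫ τ in s..t, F' τ ≤ 0 := by
    rw [intervalIntegral.integral_of_le hst, integral_Ioc_eq_integral_Ioo]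
    refine integral_nonpos_of_ae ?_
    filter_upwards [ae_restrict_of_ae_restrict_of_subset (Ioo_subset_Ioo hs0 ht.2) hd,
      ae_restrict_mem measurableSet_Ioo] with τ hτ hmem
    refine hτ (not_le.1 fun hle => ?_)
    exact hmem.1.not_ge (hmax ⟨⟨hs0.trans hmem.1.le, hmem.2.le⟩, hle⟩)
  linarith

theorem IsACOn.sub {T : ℝ} {f f' h h' : ℝ → ℝ} (hf : IsACOn T f f') (hh : IsACOn T h h') :
    IsACOn T (fun t => f t - h t) (fun t => f' t - h' t) := by
  refine ⟨hf.1.sub hh.1, fun t ht => ?_⟩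
  have hII : ∀ {u : ℝ → ℝ}, IntegrableOn u (Icc 0 T) → IntervalIntegrable u volume 0 t := fun hu =>
    (intervalIntegrable_iff_integrableOn_Icc_of_le ht.1).2
      (hu.mono_set (Icc_subset_Icc_right ht.2))
  rw [intervalIntegral.integral_sub (hII hf.1) (hII hh.1)]
  linarith [hf.2 t ht, hh.2 t ht]

/-- The play moves up only at the upper boundary of the threshold and down only at the lower
boundary. -/
theorem IsPlaySol.ae_boundary {T r : ℝ} {q ξ ξ' : ℝ → ℝ} (h : IsPlaySol T r q ξ ξ') :
    ∀ᵐ t ∂(volume.restrict (Ioo 0 T)),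
      (0 < ξ' t → r ≤ q t - ξ t) ∧ (ξ' t < 0 → q t - ξ t ≤ -r) := by
  filter_upwards [h.2.2.1] with t ht
  have h1 := ht 1 (by norm_num)
  have h2 := ht (-1) (by norm_num)
  constructor <;> intro hs <;> by_contra! hc <;> nlinarith

/-- Plays of the same input with thresholds `r ≤ s` differ by at most `s - r`. -/
theorem IsPlaySol.abs_sub_le {T r s : ℝ} {q ξ ξ' η η' : ℝ → ℝ} (hr : 0 < r) (hrs : r ≤ s)
    (hξ : IsPlaySol T r q ξ ξ') (hη : IsPlaySol T s q η η') :
    ∀ t ∈ Icc 0 T, |ξ t - η t| ≤ s - r := by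
  have h0ξ := hξ.2.2.2
  have h0η := hη.2.2.2
  have hup : ∀ t ∈ Icc 0 T, ξ t - η t ≤ s - r := by
    refine (hξ.1.sub hη.1).le_of_deriv_nonpos (by grind) ?_
    filter_upwards [hξ.ae_boundary, hη.ae_boundary, ae_restrict_mem measurableSet_Ioo]
      with t h1 h2 ht hlt
    have h3 := abs_le.1 (hξ.2.1 t (Ioo_subset_Icc_self ht))
    have h4 := abs_le.1 (hη.2.1 t (Ioo_subset_Icc_self ht))
    have h5 : ξ' t ≤ 0 := by
      by_contra! hc
      linarith [h1.1 hc]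
    have h6 : 0 ≤ η' t := by
      by_contra! hc
      linarith [h2.2 hc]
    linarith
  have hdown : ∀ t ∈ Icc 0 T, η t - ξ t ≤ s - r := by
    refine (hη.1.sub hξ.1).le_of_deriv_nonpos (by grind) ?_
    filter_upwards [hξ.ae_boundary, hη.ae_boundary, ae_restrict_mem measurableSet_Ioo]
      with t h1 h2 ht hlt
    have h3 := abs_le.1 (hξ.2.1 t (Ioo_subset_Icc_self ht))
    have h4 := abs_le.1 (hη.2.1 t (Ioo_subset_Icc_self ht))
    have h5 : 0 ≤ ξ' t := by
      by_contra! hc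
      linarith [h1.2 hc]
    have h6 : η' t ≤ 0 := by
      by_contra! hc
      linarith [h2.1 hc]
    linarith
  exact fun t ht => abs_le.2 ⟨by linarith [hdown t ht], hup t ht⟩

/-- If the inputs satisfy `q₁ - q₂ ≤ δ` whenever their plays are ordered, then the plays with the
largest threshold satisfy `η₁ - η₂ ≤ δ`. -/
theorem IsPlaySol.sub_le_of_forall_le {ι : Type*} {T s δ : ℝ} {q₁ q₂ : ℝ → ℝ} (hT : 0 < T)
    (hδ : 0 ≤ δ) {r : ι → ℝ} (hr : ∀ j, 0 < r j) (hrs : ∀ j, r j ≤ s) {ξ₁ ξ₂ : ι → ℝ → ℝ}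
    (hξ₁ : ∀ j, ∃ d, IsPlaySol T (r j) q₁ (ξ₁ j) d)
    (hξ₂ : ∀ j, ∃ d, IsPlaySol T (r j) q₂ (ξ₂ j) d)
    {η₁ η₁' η₂ η₂' : ℝ → ℝ} (hη₁ : IsPlaySol T s q₁ η₁ η₁') (hη₂ : IsPlaySol T s q₂ η₂ η₂')
    (hle : ∀ t ∈ Icc 0 T, (∀ j, ξ₂ j t ≤ ξ₁ j t) → η₂ t ≤ η₁ t → q₁ t - q₂ t ≤ δ) :
    ∀ t ∈ Icc 0 T, η₁ t - η₂ t ≤ δ := by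
  have hnest₁ : ∀ t ∈ Icc 0 T, ∀ j, |ξ₁ j t - η₁ t| ≤ s - r j := fun t ht j =>
    (hξ₁ j).choose_spec.abs_sub_le (hr j) (hrs j) hη₁ t ht
  have hnest₂ : ∀ t ∈ Icc 0 T, ∀ j, |ξ₂ j t - η₂ t| ≤ s - r j := fun t ht j =>
    (hξ₂ j).choose_spec.abs_sub_le (hr j) (hrs j) hη₂ t ht
  refine (hη₁.1.sub hη₂.1).le_of_deriv_nonpos ?_ ?_
  · have h1 := hη₁.2.2.2
    have h2 := hη₂.2.2.2
    by_contra! hc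
    have hq : q₂ 0 ≤ q₁ 0 := by grind
    have h3 := hle 0 ⟨le_rfl, hT.le⟩ (fun j => by
      rw [(hξ₁ j).choose_spec.2.2.2, (hξ₂ j).choose_spec.2.2.2]
      gcongr) (by linarith)
    grind
  · filter_upwards [hη₁.ae_boundary, hη₂.ae_boundary, ae_restrict_mem measurableSet_Ioo]
      with t h1 h2 ht hlt
    have ht := Ioo_subset_Icc_self ht
    have h3 := abs_le.1 (hη₁.2.1 t ht)
    have h4 := abs_le.1 (hη₂.2.1 t ht)
    by_contra! hc
    rcases lt_or_ge 0 (η₁' t) with hpos | hneg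
    · have h5 := h1.1 hpos
      have h6 := hle t ht (fun j => by
        linarith [abs_le.1 (hnest₂ t ht j), abs_le.1 ((hξ₁ j).choose_spec.2.1 t ht)])
        (by linarith)
      linarith
    · have h5 := h2.2 (by linarith)
      have h6 := hle t ht (fun j => by
        linarith [abs_le.1 (hnest₁ t ht j), abs_le.1 ((hξ₂ j).choose_spec.2.1 t ht)])
        (by linarith)
      linarith

/-- Pointwise form of the Lipschitz estimate: a bound `δ` on the difference of the right-hand sides
bounds the difference of the inputs by `∏ j, (1 + bbar * μ j)` times `δ`. -/
theorem abs_sub_le_prod_mul_of_isPlaySol {T bbar : ℝ} (hT : 0 < T) {b : ℝ → ℝ}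
    (hb : ∀ t ∈ Icc 0 T, 0 ≤ b t ∧ b t ≤ bbar) {q₁ q₂ : ℝ → ℝ} (k : ℕ)
    (r : Fin k → ℝ) (hr : ∀ j, 0 < r j) (hrmono : Monotone r)
    (g : Fin k → ℝ → ℝ) (μ : Fin k → ℝ) (hμ : ∀ j, 0 ≤ μ j) (hgmono : ∀ j, Monotone (g j))
    (hglip : ∀ j, LipschitzWith (Real.toNNReal (μ j)) (g j)) (ξ₁ ξ₂ : Fin k → ℝ → ℝ)
    (hξ₁ : ∀ j, ∃ d, IsPlaySol T (r j) q₁ (ξ₁ j) d)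
    (hξ₂ : ∀ j, ∃ d, IsPlaySol T (r j) q₂ (ξ₂ j) d) (δ : ℝ)
    (hδ : ∀ t ∈ Icc 0 T,
      |(q₁ t + b t * ∑ j, g j (ξ₁ j t)) - (q₂ t + b t * ∑ j, g j (ξ₂ j t))| ≤ δ) :
    ∀ t ∈ Icc 0 T, |q₁ t - q₂ t| ≤ (∏ j, (1 + bbar * μ j)) * δ := by
  induction k generalizing δ with
  | zero => simpa using hδ
  | succ k ih =>
    have hδ0 : 0 ≤ δ := (abs_nonneg _).trans (hδ 0 ⟨le_rfl, hT.le⟩)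
    obtain ⟨d₁, hd₁⟩ := hξ₁ (Fin.last k)
    obtain ⟨d₂, hd₂⟩ := hξ₂ (Fin.last k)
    have hup := IsPlaySol.sub_le_of_forall_le hT hδ0 hr (fun j => hrmono (Fin.le_last j))
      hξ₁ hξ₂ hd₁ hd₂ fun t ht hle _ => by
        have h1 : b t * ∑ j, g j (ξ₂ j t) ≤ b t * ∑ j, g j (ξ₁ j t) :=
          mul_le_mul_of_nonneg_left (Finset.sum_le_sum fun j _ => hgmono j (hle j)) (hb t ht).1
        linarith [abs_le.1 (hδ t ht)]
    have hdown := IsPlaySol.sub_le_of_forall_le hT hδ0 hr (fun j => hrmono (Fin.le_last j))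
      hξ₂ hξ₁ hd₂ hd₁ fun t ht hle _ => by
        have h1 : b t * ∑ j, g j (ξ₁ j t) ≤ b t * ∑ j, g j (ξ₂ j t) :=
          mul_le_mul_of_nonneg_left (Finset.sum_le_sum fun j _ => hgmono j (hle j)) (hb t ht).1
        linarith [abs_le.1 (hδ t ht)]
    rw [Fin.prod_univ_castSucc, mul_assoc]
    refine ih (fun j => r j.castSucc) (fun j => hr _)
      (fun i j hij => hrmono (Fin.castSucc_le_castSucc_iff.2 hij)) (fun j => g j.castSucc)
      (fun j => μ j.castSucc) (fun j => hμ _) (fun j => hgmono _) (fun j => hglip _)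
      (fun j => ξ₁ j.castSucc) (fun j => ξ₂ j.castSucc) (fun j => hξ₁ _) (fun j => hξ₂ _) _
      fun t ht => ?_
    set G := g (Fin.last k)
    set m := μ (Fin.last k)
    set x := ξ₁ (Fin.last k) t
    set y := ξ₂ (Fin.last k) t
    have hxy : |x - y| ≤ δ := abs_le.2 ⟨by linarith [hdown t ht], hup t ht⟩
    have hG : |G x - G y| ≤ m * δ := by
      have h1 := (hglip (Fin.last k)).dist_le_mul x y
      rw [Real.dist_eq, Real.dist_eq, Real.coe_toNNReal _ (hμ _)] at h1
      exact h1.trans (mul_le_mul_of_nonneg_left hxy (hμ _))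
    have hbG : |b t * (G x - G y)| ≤ bbar * (m * δ) := by
      rw [abs_mul, abs_of_nonneg (hb t ht).1]
      exact mul_le_mul (hb t ht).2 hG (abs_nonneg _) ((hb t ht).1.trans (hb t ht).2)
    have h2 := hδ t ht
    rw [Fin.sum_univ_castSucc, Fin.sum_univ_castSucc] at h2
    rw [abs_le] at h2 hbG ⊢
    constructor <;> linarith

/-- Proposition 2: Lipschitz estimate for the inversion of discrete Preisach
operators with time dependent coefficient `b`. The g_j are Lipschitz with
`g_j(0) = 0` and `0 ≤ g_j' ≤ μ_j` a.e. (i.e. nondecreasing and `μ_j`-Lipschitz). -/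
theorem stmt_2 (T bbar : ℝ) (hT : 0 < T) (k : ℕ)
    (r : Fin k → ℝ) (hrpos : ∀ j, 0 < r j) (hrmono : StrictMono r)
    (g : Fin k → ℝ → ℝ) (μ : Fin k → ℝ) (hμ : ∀ j, 0 ≤ μ j)
    (hg0 : ∀ j, g j 0 = 0) (hgmono : ∀ j, Monotone (g j))
    (hglip : ∀ j, LipschitzWith (Real.toNNReal (μ j)) (g j))
    (b : ℝ → ℝ) (hb : ContinuousOn b (Icc 0 T))
    (hbrange : ∀ t ∈ Icc 0 T, 0 ≤ b t ∧ b t ≤ bbar)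
    (q₁ q₂ q₁' q₂' : ℝ → ℝ) (hq₁ : IsACOn T q₁ q₁') (hq₂ : IsACOn T q₂ q₂')
    (ξ₁ ξ₂ : Fin k → ℝ → ℝ)
    (hξ₁ : ∀ j, ∃ d, IsPlaySol T (r j) q₁ (ξ₁ j) d)
    (hξ₂ : ∀ j, ∃ d, IsPlaySol T (r j) q₂ (ξ₂ j) d)
    (w₁ w₂ : ℝ → ℝ)
    (hw₁ : ContinuousOn w₁ (Icc 0 T)) (hw₂ : ContinuousOn w₂ (Icc 0 T))
    (heq₁ : ∀ t ∈ Icc 0 T, q₁ t + b t * ∑ j, g j (ξ₁ j t) = w₁ t)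
    (heq₂ : ∀ t ∈ Icc 0 T, q₂ t + b t * ∑ j, g j (ξ₂ j t) = w₂ t) :
    (⨆ t : Icc (0:ℝ) T, |q₁ t - q₂ t|) ≤
      (∏ j, (1 + bbar * μ j)) * ⨆ t : Icc (0:ℝ) T, |w₁ t - w₂ t| := by
  have : Nonempty (Icc (0:ℝ) T) := ⟨⟨0, le_rfl, hT.le⟩⟩
  have hbdd : BddAbove (range fun t : Icc (0:ℝ) T => |w₁ t - w₂ t|) := by
    have h := (isCompact_Icc (a := (0:ℝ)) (b := T)).bddAbove_image (hw₁.sub hw₂).abs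
    rwa [image_eq_range] at h
  refine ciSup_le fun t => abs_sub_le_prod_mul_of_isPlaySol hT hbrange k r hrpos hrmono.monotone
    g μ hμ hgmono hglip ξ₁ ξ₂ hξ₁ hξ₂ _ (fun s hs => ?_) t t.2
  rw [heq₁ s hs, heq₂ s hs]
  exact le_ciSup hbdd ⟨s, hs⟩
end

section
/- Let T > 0, r > 0, let q₁, q₂ : [0,T] → ℝ be absolutely continuous, and for i = 1,2 let ξ^i be the solution of the play variational inequality with threshold r and input q_i. Then for every t ∈ [0,T] one has |ξ¹(t) − ξ²(t)| ≤ max_{τ∈[0,t]} |q₁(τ) − q₂(τ)|. -/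
open MeasureTheory Set

namespace IsACOn

variable {T : ℝ} {q q' : ℝ → ℝ}

theorem intervalIntegrable (h : IsACOn T q q') {a b : ℝ} (ha : a ∈ Icc 0 T) (hb : b ∈ Icc 0 T) :
    IntervalIntegrable q' volume a b :=
  ((intervalIntegrable_iff_integrableOn_Icc_of_le (ha.1.trans ha.2)).2 h.1).mono_set <| by
    rw [uIcc_of_le (ha.1.trans ha.2)]
    exact uIcc_subset_Icc ha hb

theorem sub_eq_integral (h : IsACOn T q q') {a b : ℝ} (ha : a ∈ Icc 0 T) (hb : b ∈ Icc 0 T) :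
    q b - q a = ∫ τ in a..b, q' τ := by
  have h0 : (0 : ℝ) ∈ Icc 0 T := ⟨le_rfl, ha.1.trans ha.2⟩
  rw [h.2 b hb, h.2 a ha, add_sub_add_left_eq_sub,
    intervalIntegral.integral_interval_sub_left (h.intervalIntegrable h0 hb)
      (h.intervalIntegrable h0 ha)]

theorem continuousOn (h : IsACOn T q q') : ContinuousOn q (Icc 0 T) := by
  rcases lt_or_ge T 0 with hT | hT
  · simp [Icc_eq_empty_of_lt hT]
  · have hc := intervalIntegral.continuousOn_primitive_interval (a := 0) (b := T) (f := q')
      (μ := volume) (by rw [uIcc_of_le hT]; exact h.1)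
    rw [uIcc_of_le hT] at hc
    exact (hc.const_add (q 0)).congr h.2

end IsACOn

theorem IsPlaySol.sub_le_of_initial_le {T r M t : ℝ} {q₁ q₂ ξ₁ ξ₁' ξ₂ ξ₂' : ℝ → ℝ}
    (h₁ : IsPlaySol T r q₁ ξ₁ ξ₁') (h₂ : IsPlaySol T r q₂ ξ₂ ξ₂') (ht : t ∈ Icc 0 T)
    (h0 : ξ₁ 0 - ξ₂ 0 ≤ M) (hM : ∀ τ ∈ Icc 0 t, q₁ τ - q₂ τ ≤ M) :
    ξ₁ t - ξ₂ t ≤ M := by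
  obtain ⟨hac₁, hb₁, hv₁, -⟩ := h₁
  obtain ⟨hac₂, hb₂, hv₂, -⟩ := h₂
  have hsub : Icc 0 t ⊆ Icc 0 T := Icc_subset_Icc_right ht.2
  have hcont : ContinuousOn (fun u => ξ₁ u - ξ₂ u) (Icc 0 t) :=
    (hac₁.continuousOn.sub hac₂.continuousOn).mono hsub
  -- `s` is the last time before `t` at which the difference is at most `M`.
  have hcpt : IsCompact (Icc 0 t ∩ (fun u => ξ₁ u - ξ₂ u) ⁻¹' Iic M) :=
    isCompact_Icc.of_isClosed_subset (hcont.preimage_isClosed_of_isClosed isClosed_Icc isClosed_Iic)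
      inter_subset_left
  obtain ⟨s, ⟨hs, hsM⟩, hmax⟩ := hcpt.exists_isGreatest ⟨0, ⟨le_rfl, ht.1⟩, h0⟩
  have hsM' : ξ₁ s - ξ₂ s ≤ M := hsM
  have hgt : ∀ u ∈ Ioo s t, M < ξ₁ u - ξ₂ u := fun u hu => by
    by_contra! hle
    exact hu.1.not_ge (hmax ⟨⟨hs.1.trans hu.1.le, hu.2.le⟩, hle⟩)
  have hIoo : Ioo s t ⊆ Ioo 0 T := Ioo_subset_Ioo hs.1 ht.2
  have hderiv : ∀ᵐ u ∂volume.restrict (Ioo s t), ξ₁' u ≤ ξ₂' u := by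
    filter_upwards [ae_restrict_of_ae_restrict_of_subset hIoo hv₁,
      ae_restrict_of_ae_restrict_of_subset hIoo hv₂, ae_restrict_mem measurableSet_Ioo]
      with u hu₁ hu₂ hu
    have hlt := hgt u hu
    have huI : u ∈ Icc 0 t := ⟨hs.1.trans hu.1.le, hu.2.le⟩
    have hq := hM u huI
    have hr₁ := abs_le.1 (hb₁ u (hsub huI))
    have hr₂ := abs_le.1 (hb₂ u (hsub huI))
    have hp₁ := hu₁ 1 (by norm_num)
    have hp₂ := hu₂ (-1) (by norm_num)
    have hneg : ξ₁' u ≤ 0 := nonpos_of_mul_nonneg_left hp₁ (by linarith)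
    have hpos : 0 ≤ ξ₂' u := nonneg_of_mul_nonneg_left hp₂ (by linarith)
    exact hneg.trans hpos
  have hint : ∫ u in s..t, ξ₁' u ≤ ∫ u in s..t, ξ₂' u := by
    refine intervalIntegral.integral_mono_ae_restrict hs.2
      (hac₁.intervalIntegrable (hsub hs) ht) (hac₂.intervalIntegrable (hsub hs) ht) ?_
    rwa [Filter.EventuallyLE, ← restrict_Ioo_eq_restrict_Icc]
  rw [← hac₁.sub_eq_integral (hsub hs) ht, ← hac₂.sub_eq_integral (hsub hs) ht] at hint
  linarith

theorem abs_clamp_sub_clamp_le (r a b : ℝ) :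
    |max (a - r) (min 0 (a + r)) - max (b - r) (min 0 (b + r))| ≤ |a - b| := by
  refine (abs_max_sub_max_le_max _ _ _ _).trans (max_le (by simp) ?_)
  refine (abs_min_sub_min_le_max _ _ _ _).trans (max_le (by simp) (by simp))

/-- The play operator is Lipschitz continuous with constant 1 in the Volterra
sense: `|ξ¹(t) - ξ²(t)| ≤ max_{τ∈[0,t]} |q₁(τ) - q₂(τ)|`. -/
theorem stmt_13 (T r : ℝ) (hT : 0 < T) (hr : 0 < r)
    (q₁ q₂ q₁' q₂' ξ₁ ξ₁' ξ₂ ξ₂' : ℝ → ℝ)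
    (hq₁ : IsACOn T q₁ q₁') (hq₂ : IsACOn T q₂ q₂')
    (h₁ : IsPlaySol T r q₁ ξ₁ ξ₁') (h₂ : IsPlaySol T r q₂ ξ₂ ξ₂') :
    ∀ t ∈ Icc 0 T, |ξ₁ t - ξ₂ t| ≤ ⨆ τ : Icc (0:ℝ) t, |q₁ τ - q₂ τ| := by
  intro t ht
  have hsub : Icc 0 t ⊆ Icc 0 T := Icc_subset_Icc_right ht.2
  have hbdd : BddAbove (range fun τ : Icc (0:ℝ) t => |q₁ τ - q₂ τ|) := by
    have hc := (((hq₁.continuousOn.sub hq₂.continuousOn).mono hsub).abs)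
    simpa [image_eq_range] using isCompact_Icc.bddAbove_image hc
  have hM : ∀ τ ∈ Icc 0 t, |q₁ τ - q₂ τ| ≤ ⨆ τ : Icc (0:ℝ) t, |q₁ τ - q₂ τ| :=
    fun τ hτ => le_ciSup hbdd ⟨τ, hτ⟩
  have h0 : |ξ₁ 0 - ξ₂ 0| ≤ ⨆ τ : Icc (0:ℝ) t, |q₁ τ - q₂ τ| := by
    rw [h₁.2.2.2, h₂.2.2.2]
    exact (abs_clamp_sub_clamp_le r _ _).trans (hM 0 ⟨le_rfl, ht.1⟩)
  rw [abs_sub_le_iff] at h0 ⊢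
  exact ⟨h₁.sub_le_of_initial_le h₂ ht h0.1 fun τ hτ => (abs_sub_le_iff.1 (hM τ hτ)).1,
    h₂.sub_le_of_initial_le h₁ ht h0.2 fun τ hτ => (abs_sub_le_iff.1 (hM τ hτ)).2⟩
end
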